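/- Let ι be a type and let i₁ ≠ i₂ be two elements of ι; write e₁ = FreeGroup.of i₁ and e₂ = FreeGroup.of i₂ in F = FreeGroup ι. For integers l, k ∈ ℤ, let φ_{l,k} : FreeGroup (ι ⊕ Fin 2) →* F be the group homomorphism determined on generators by Sum.inl i ↦ FreeGroup.of i, Sum.inr 0 ↦ e₂^l, and Sum.inr 1 ↦ e₂^k. Let ε : FreeGroup (ι ⊕ Fin 2) →* ℤ be the exponent-sum homomorphism determined by Sum.inl i₁ ↦ 1 and all other generators ↦ 0. Then for every word w ∈ FreeGroup (ι ⊕ Fin 2), all l, k ∈ ℤ, and every n ∈ ℤ: if φ_{l,k}(w) = e₁^n then n = ε(w). In particular, for a fixed w there is at most one n ∈ ℤ for which e₁^n lies in the set { φ_{l,k}(w) : l, k ∈ ℤ }; hence if (k_n) is a strictly increasing sequence of integers, then φ_{l_n,m_n}(w) = e₁^{k_n} can hold for at most one index n, for any choice of integers l_n, m_n. -/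

import Mathlib

/-!
STATEMENT 1: Key word-combinatorics lemma.

`φ_{l,k} : FreeGroup (ι ⊕ Fin 2) →* FreeGroup ι` sends `Sum.inl i ↦ FreeGroup.of i`,
`Sum.inr 0 ↦ e₂ ^ l`, `Sum.inr 1 ↦ e₂ ^ k`, and
`ε : FreeGroup (ι ⊕ Fin 2) →* Multiplicative ℤ` is the exponent-sum homomorphism in the
letter `i₁` (`Sum.inl i₁ ↦ 1 ∈ ℤ`, all other generators `↦ 0 ∈ ℤ`).
If `φ_{l,k} w = e₁ ^ n` then `n = ε w`; consequently for a strictly increasing sequence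
`(kₙ)` of integers, `φ_{lₙ,mₙ}(w) = e₁ ^ kₙ` can hold for at most one index `n`.
-/
theorem diagonal_word_exponent_sum {ι : Type*} [DecidableEq ι] (i₁ i₂ : ι) (hne : i₁ ≠ i₂)
    (e₁ e₂ : FreeGroup ι) (he₁ : e₁ = FreeGroup.of i₁) (he₂ : e₂ = FreeGroup.of i₂)
    (φ : ℤ → ℤ → (FreeGroup (ι ⊕ Fin 2) →* FreeGroup ι))
    (hφ : ∀ l k : ℤ, φ l k =
      FreeGroup.lift (Sum.elim (fun i => FreeGroup.of i)
        (fun j : Fin 2 => if j = 0 then e₂ ^ l else e₂ ^ k)))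
    (ε : FreeGroup (ι ⊕ Fin 2) →* Multiplicative ℤ)
    (hε : ε = FreeGroup.lift (Sum.elim
      (fun i => if i = i₁ then Multiplicative.ofAdd (1 : ℤ) else 1) (fun _ => 1))) :
    (∀ (w : FreeGroup (ι ⊕ Fin 2)) (l k n : ℤ),
        φ l k w = e₁ ^ n → n = Multiplicative.toAdd (ε w)) ∧
    (∀ (w : FreeGroup (ι ⊕ Fin 2)) (kseq : ℕ → ℤ), StrictMono kseq →
      ∀ (lseq mseq : ℕ → ℤ) (n₁ n₂ : ℕ),
        φ (lseq n₁) (mseq n₁) w = e₁ ^ kseq n₁ →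
        φ (lseq n₂) (mseq n₂) w = e₁ ^ kseq n₂ → n₁ = n₂) := by
  subst he₁ he₂ hε
  let ψ : FreeGroup ι →* Multiplicative ℤ :=
    FreeGroup.lift fun i => if i = i₁ then Multiplicative.ofAdd (1 : ℤ) else 1
  have ψ_comp (l k : ℤ) : ψ.comp (φ l k) = FreeGroup.lift (Sum.elim
      (fun i => if i = i₁ then Multiplicative.ofAdd (1 : ℤ) else 1) (fun _ => 1)) := by
    rw [hφ]
    ext (i | j)
    · simp [ψ]
    · by_cases hj : j = 0 <;> simp [ψ, hj, hne.symm]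
  have exponent_eq (w : FreeGroup (ι ⊕ Fin 2)) (l k n : ℤ)
      (h : φ l k w = FreeGroup.of i₁ ^ n) :
      n = Multiplicative.toAdd (FreeGroup.lift (Sum.elim
        (fun i => if i = i₁ then Multiplicative.ofAdd (1 : ℤ) else 1) (fun _ => 1)) w) := by
    rw [← ψ_comp l k, MonoidHom.comp_apply, h]
    simp [ψ]
  exact ⟨exponent_eq, fun w _ hk _ _ _ _ h₁ h₂ =>
    hk.injective ((exponent_eq w _ _ _ h₁).trans (exponent_eq w _ _ _ h₂).symm)⟩
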